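/- arXiv:2501.12726 — 2 statements merged into one kernel-verified Lean document; each statement's English description precedes it below -/
import Mathlib

section
/- Let (α, μ) be a measure space, let p > 0 and ε > 0 be reals, and let v : α → ℝ be measurable with ∫ |v|^{p+ε} dμ < ∞. Then the function x ↦ |v(x)|^p · log|v(x)| is integrable on the set {x : |v(x)| ≥ 1}, and ∫_{{|v| ≥ 1}} |v|^p · log|v| dμ ≤ (1/(e·ε)) · ∫ |v|^{p+ε} dμ. -/
open MeasureTheory

/-- The sharp comparison of the logarithm with a power: `log t ≤ t ^ ε / (e ε)`. -/
theorem Real.log_le_rpow_div_exp_one_mul {t ε : ℝ} (ht : 0 < t) (hε : 0 < ε) :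
    Real.log t ≤ (1 / (Real.exp 1 * ε)) * t ^ ε := by
  have he := Real.exp_pos 1
  have h := Real.add_one_le_exp (Real.log t * ε - 1)
  rw [Real.exp_sub, ← Real.rpow_def_of_pos ht, sub_add_cancel, le_div_iff₀ he] at h
  rw [one_div_mul_eq_div, le_div_iff₀ (mul_pos he hε)]
  linarith

/-- If `|v| ^ (p + ε)` is integrable, then `|v| ^ p * log |v|` is integrable on the set
`{|v| ≥ 1}` and its integral there is bounded by `(1/(e ε)) ∫ |v| ^ (p + ε)`. -/
theorem log_term_integral_bound {α : Type*} [MeasurableSpace α] (μ : Measure α)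
    (p ε : ℝ) (hp : 0 < p) (hε : 0 < ε) (v : α → ℝ) (hv : Measurable v)
    (hint : Integrable (fun x => |v x| ^ (p + ε)) μ) :
    IntegrableOn (fun x => |v x| ^ p * Real.log |v x|) {x | 1 ≤ |v x|} μ ∧
      ∫ x in {x | 1 ≤ |v x|}, |v x| ^ p * Real.log |v x| ∂μ ≤
        (1 / (Real.exp 1 * ε)) * ∫ x, |v x| ^ (p + ε) ∂μ := by
  have habs : Measurable fun x => |v x| := hv.abs
  have hs : MeasurableSet {x | 1 ≤ |v x|} := measurableSet_le measurable_const habs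
  have hbound : ∀ x ∈ {x | 1 ≤ |v x|},
      |v x| ^ p * Real.log |v x| ≤ (1 / (Real.exp 1 * ε)) * |v x| ^ (p + ε) := by
    intro x hx
    have hpos : 0 < |v x| := zero_lt_one.trans_le hx
    rw [Real.rpow_add hpos, mul_left_comm]
    exact mul_le_mul_of_nonneg_left (Real.log_le_rpow_div_exp_one_mul hpos hε)
      (Real.rpow_nonneg hpos.le p)
  have hmajor := hint.const_mul (1 / (Real.exp 1 * ε))
  have hlog : IntegrableOn (fun x => |v x| ^ p * Real.log |v x|) {x | 1 ≤ |v x|} μ := by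
    refine hmajor.integrableOn.mono'
      ((habs.pow_const p).mul habs.log).aestronglyMeasurable ?_
    filter_upwards [ae_restrict_mem hs] with x hx
    rw [Real.norm_of_nonneg (mul_nonneg (Real.rpow_nonneg (abs_nonneg _) _)
      (Real.log_nonneg hx))]
    exact hbound x hx
  refine ⟨hlog, ?_⟩
  rw [← integral_const_mul]
  refine (setIntegral_mono_on hlog hmajor.integrableOn hs hbound).trans
    (setIntegral_le_integral hmajor (ae_of_all _ fun x => ?_))
  simp only [Pi.zero_apply]
  positivity
end

section
/- Let (α, μ) be a measure space with μ(α) < ∞, let p > 1 and ε > 0 be reals, and let v : α → ℝ be measurable with ∫ |v|^{2(p−1+ε)} dμ < ∞. Then the function x ↦ |v(x)|^{2(p−1)} · (log|v(x)|)² (with the convention that it equals 0 where v(x) = 0) is integrable and ∫ |v|^{2(p−1)} · (log|v|)² dμ ≤ (e(p−1))^{−2} · μ(α) + (e·ε)^{−2} · ∫ |v|^{2(p−1+ε)} dμ. -/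
open MeasureTheory

theorem Real.log_le_inv_exp_one_mul_rpow {t s : ℝ} (ht : 0 < t) (hs : 0 < s) :
    Real.log t ≤ (Real.exp 1 * s)⁻¹ * t ^ s := by
  rw [inv_mul_eq_div, le_div_iff₀ (by positivity), Real.rpow_def_of_pos ht]
  have h := Real.add_one_le_exp (Real.log t * s - 1)
  rw [Real.exp_sub, le_div_iff₀ (Real.exp_pos 1)] at h
  linarith

theorem Real.rpow_mul_log_sq_le {t q ε : ℝ} (ht : 0 ≤ t) (hq : 0 < q) (hε : 0 < ε) :
    t ^ (2 * q) * Real.log t ^ 2 ≤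
      (Real.exp 1 * q)⁻¹ ^ 2 + (Real.exp 1 * ε)⁻¹ ^ 2 * t ^ (2 * (q + ε)) := by
  obtain rfl | ht := ht.eq_or_lt
  · rw [Real.log_zero, zero_pow two_ne_zero, mul_zero]
    positivity
  have hpow (s : ℝ) : t ^ (2 * s) = (t ^ s) ^ 2 := by
    rw [mul_comm, Real.rpow_mul ht.le, Real.rpow_two]
  rw [hpow, hpow, Real.rpow_add ht, ← mul_pow, ← mul_pow]
  have htq : 0 < t ^ q := Real.rpow_pos_of_pos ht q
  rcases le_total 0 (Real.log t) with hlog | hlog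
  · refine le_add_of_nonneg_of_le (by positivity) (pow_le_pow_left₀ (by positivity) ?_ 2)
    calc t ^ q * Real.log t ≤ t ^ q * ((Real.exp 1 * ε)⁻¹ * t ^ ε) := by
          gcongr
          exact Real.log_le_inv_exp_one_mul_rpow ht hε
      _ = _ := by ring
  · refine le_add_of_le_of_nonneg ?_ (by positivity)
    rw [← neg_sq (t ^ q * _), ← mul_neg]
    refine pow_le_pow_left₀ (mul_nonneg htq.le (neg_nonneg.2 hlog)) ?_ 2
    have h := Real.log_le_inv_exp_one_mul_rpow (inv_pos.2 ht) hq
    rw [Real.log_inv, Real.inv_rpow ht.le, ← div_eq_mul_inv, le_div_iff₀ htq] at h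
    linarith

/-- Estimate (3.27): on a finite measure space, if `|v| ^ (2(p−1+ε))` is integrable then
so is `|v| ^ (2(p−1)) (log |v|)²`, with
`∫ |v|^(2(p−1)) (log|v|)² ≤ (e(p−1))⁻² μ(α) + (e ε)⁻² ∫ |v|^(2(p−1+ε))`. -/
theorem log_source_square_integral_bound {α : Type*} [MeasurableSpace α] (μ : Measure α)
    [IsFiniteMeasure μ] (p ε : ℝ) (hp : 1 < p) (hε : 0 < ε)
    (v : α → ℝ) (hv : Measurable v)
    (hint : Integrable (fun x => |v x| ^ (2 * (p - 1 + ε))) μ) :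
    Integrable (fun x => |v x| ^ (2 * (p - 1)) * (Real.log |v x|) ^ 2) μ ∧
      ∫ x, |v x| ^ (2 * (p - 1)) * (Real.log |v x|) ^ 2 ∂μ ≤
        (Real.exp 1 * (p - 1))⁻¹ ^ 2 * (μ Set.univ).toReal +
          (Real.exp 1 * ε)⁻¹ ^ 2 * ∫ x, |v x| ^ (2 * (p - 1 + ε)) ∂μ := by
  have hbound (x : α) := Real.rpow_mul_log_sq_le (abs_nonneg (v x)) (sub_pos.2 hp) hε
  have hint' := (integrable_const (μ := μ) ((Real.exp 1 * (p - 1))⁻¹ ^ 2)).add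
    (hint.const_mul ((Real.exp 1 * ε)⁻¹ ^ 2))
  have hleft : Integrable (fun x => |v x| ^ (2 * (p - 1)) * (Real.log |v x|) ^ 2) μ := by
    refine hint'.mono' (by fun_prop) (.of_forall fun x => ?_)
    rw [Real.norm_of_nonneg (by positivity)]
    exact hbound x
  refine ⟨hleft, (integral_mono hleft hint' hbound).trans_eq ?_⟩
  simp only [Pi.add_apply]
  rw [integral_add (integrable_const _) (hint.const_mul _), integral_const, integral_const_mul,
    smul_eq_mul, mul_comm, Measure.real]
end
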